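/- Given two weight functions w¹ and w², the set of stable matchings maximizing Σ w²_{bg} among those maximizing Σ w¹_{bg} is nonempty and forms a sublattice of the stable matching lattice. -/

import Mathlib

/-- `rB b g` is the rank boy `b` gives girl `g` (smaller = more preferred), and
`rG g b` the rank girl `g` gives boy `b`.  A matching (bijection) `M` is stable if
no pair `(b, g)` prefer each other to their partners. -/
def StableM {B G : Type*} (rB : B → G → ℕ) (rG : G → B → ℕ) (M : B ≃ G) : Prop :=
  ∀ (b : B) (g : G), ¬ (rB b g < rB b (M b) ∧ rG g b < rG g (M.symm g))

/-- The total weight of a matching. -/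
def matchWeight {B G : Type*} [Fintype B] (w : B → G → ℚ) (M : B ≃ G) : ℚ :=
  ∑ b, w b (M b)

/-- A maximum weight stable matching. -/
def MaxWtStable {B G : Type*} [Fintype B] (rB : B → G → ℕ) (rG : G → B → ℕ)
    (w : B → G → ℚ) (M : B ≃ G) : Prop :=
  StableM rB rG M ∧ ∀ N : B ≃ G, StableM rB rG N → matchWeight w N ≤ matchWeight w M

/-- A stable matching maximizing `w²`-weight among the stable matchings maximizing
`w¹`-weight. -/
def BiOptimal {B G : Type*} [Fintype B] (rB : B → G → ℕ) (rG : G → B → ℕ)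
    (w1 w2 : B → G → ℚ) (M : B ≃ G) : Prop :=
  MaxWtStable rB rG w1 M ∧
    ∀ N : B ≃ G, MaxWtStable rB rG w1 N → matchWeight w2 N ≤ matchWeight w2 M

/-- The pairs `(b, g)` such that `b` has been rejected by every girl he prefers to `g`,
where `R` is the set of rejected pairs. -/
def proposals {B G : Type*} (rB : B → G → ℕ) (R : Set (B × G)) : Set (B × G) :=
  {p | ∀ g, rB p.1 g < rB p.1 p.2 → (p.1, g) ∈ R}

/-- The pairs `(b, g)` such that `g` has a better proposal than that of `b`,
where `P` is the set of proposals. -/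
def rejections {B G : Type*} (rG : G → B → ℕ) (P : Set (B × G)) : Set (B × G) :=
  {p | ∃ b, (b, p.2) ∈ P ∧ rG p.2 b < rG p.2 p.1}

theorem exists_rejections_proposals_eq {B G : Type*} (rB : B → G → ℕ) (rG : G → B → ℕ) :
    ∃ R : Set (B × G), rejections rG (proposals rB R) = R := by
  let F : Set (B × G) →o Set (B × G) :=
    { toFun := fun R => rejections rG (proposals rB R)
      monotone' := by
        rintro R S hRS p ⟨b, hb, hlt⟩
        exact ⟨b, fun g hg => hRS (hb g hg), hlt⟩ }
  exact ⟨F.lfp, F.map_lfp⟩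

/-- Gale–Shapley: a stable matching exists. -/
theorem exists_stableM {B G : Type*} [Fintype B] [Fintype G]
    (rB : B → G → ℕ) (rG : G → B → ℕ)
    (hrB : ∀ b, Function.Injective (rB b)) (hrG : ∀ g, Function.Injective (rG g))
    (hcard : Fintype.card B = Fintype.card G) :
    ∃ M : B ≃ G, StableM rB rG M := by
  obtain ⟨R, hR⟩ := exists_rejections_proposals_eq rB rG
  have mem_R (b : B) (g : G) :
      (b, g) ∈ R ↔ ∃ b', (b', g) ∈ proposals rB R ∧ rG g b' < rG g b := by
    conv_lhs => rw [← hR]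
    rfl
  have girl_holds (g : G) (b : B) (hb : (b, g) ∈ proposals rB R) :
      ∃ b', (b', g) ∈ proposals rB R ∧ (b', g) ∉ R ∧ rG g b' ≤ rG g b := by
    obtain ⟨c, hc, hmin⟩ := exists_minimalFor_of_wellFoundedLT
      (fun c => (c, g) ∈ proposals rB R) (rG g) ⟨b, hb⟩
    have hle : ∀ d, (d, g) ∈ proposals rB R → rG g c ≤ rG g d := fun d hd =>
      (le_total (rG g c) (rG g d)).elim id (hmin hd)
    refine ⟨c, hc, fun h => ?_, hle b hb⟩
    obtain ⟨d, hd, hlt⟩ := (mem_R c g).1 h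
    exact (hle d hd).not_gt hlt
  have boy_unique {b : B} {g g' : G} (h : (b, g) ∈ proposals rB R) (hn : (b, g) ∉ R)
      (h' : (b, g') ∈ proposals rB R) (hn' : (b, g') ∉ R) : g = g' := by
    refine hrB b (le_antisymm ?_ ?_)
    · exact not_lt.1 fun hlt => hn' (h g' hlt)
    · exact not_lt.1 fun hlt => hn (h' g hlt)
  have girl_unique {b b' : B} {g : G} (h : (b, g) ∈ proposals rB R) (hn : (b, g) ∉ R)
      (h' : (b', g) ∈ proposals rB R) (hn' : (b', g) ∉ R) : b = b' := by
    refine hrG g (le_antisymm ?_ ?_)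
    · exact not_lt.1 fun hlt => hn ((mem_R b g).2 ⟨b', h', hlt⟩)
    · exact not_lt.1 fun hlt => hn' ((mem_R b' g).2 ⟨b, h, hlt⟩)
  have boy_holds (b : B) : ∃ g, (b, g) ∈ proposals rB R ∧ (b, g) ∉ R := by
    by_cases hall : ∀ g, (b, g) ∈ R
    · have hheld (g : G) : ∃ c, (c, g) ∈ proposals rB R ∧ (c, g) ∉ R := by
        obtain ⟨b', hb', -⟩ := (mem_R b g).1 (hall g)
        obtain ⟨c, hc, hcR, -⟩ := girl_holds g b' hb'
        exact ⟨c, hc, hcR⟩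
      choose f hf hfR using hheld
      have hinj : Function.Injective f := fun g g' hgg' =>
        boy_unique (hf g) (hfR g) (hgg' ▸ hf g') (hgg' ▸ hfR g')
      obtain ⟨g, rfl⟩ := ((Fintype.bijective_iff_injective_and_card f).2
        ⟨hinj, hcard.symm⟩).surjective b
      exact ⟨g, hf g, hfR g⟩
    · push Not at hall
      obtain ⟨g, hg, hmin⟩ := exists_minimalFor_of_wellFoundedLT
        (fun g => (b, g) ∉ R) (rB b) hall
      exact ⟨g, fun g' hlt => by_contra fun h => hlt.not_ge (hmin h hlt.le), hg⟩
  choose f hf hfR using boy_holds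
  have hinj : Function.Injective f := fun b b' hbb' =>
    girl_unique (hf b) (hfR b) (hbb' ▸ hf b') (hbb' ▸ hfR b')
  let M := Equiv.ofBijective f ((Fintype.bijective_iff_injective_and_card f).2 ⟨hinj, hcard⟩)
  refine ⟨M, fun b g ⟨hb, hg⟩ => ?_⟩
  obtain ⟨b', hb', hlt⟩ := (mem_R b g).1 (hf b g hb)
  obtain ⟨c, hc, hcR, hle⟩ := girl_holds g b' hb'
  have hM : f (M.symm g) = g := M.apply_symm_apply g
  have hcM : c = M.symm g :=
    girl_unique hc hcR (by simpa only [hM] using hf (M.symm g))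
      (by simpa only [hM] using hfR (M.symm g))
  rw [← hcM] at hg
  exact absurd hg (hle.trans hlt.le).not_gt

/-- Stable matchings are closed under the boy-better meet and the boy-worse join. -/
theorem StableM.exists_meet_join {B G : Type*} [Fintype B] [Fintype G]
    {rB : B → G → ℕ} {rG : G → B → ℕ}
    (hrB : ∀ b, Function.Injective (rB b)) (hrG : ∀ g, Function.Injective (rG g))
    {M M' : B ≃ G} (hM : StableM rB rG M) (hM' : StableM rB rG M') :
    ∃ Mmeet Mjoin : B ≃ G,
      (∀ b, Mmeet b = if rB b (M b) ≤ rB b (M' b) then M b else M' b) ∧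
      (∀ b, Mjoin b = if rB b (M b) ≤ rB b (M' b) then M' b else M b) ∧
      StableM rB rG Mmeet ∧ StableM rB rG Mjoin := by
  have hcard := Fintype.card_congr M
  -- No girl is the better partner of two distinct boys.
  have cross {b c : B} (hb : rB b (M b) ≤ rB b (M' b)) (hc : ¬ rB c (M c) ≤ rB c (M' c)) :
      M b ≠ M' c := by
    intro h
    have hbc : b ≠ c := by rintro rfl; exact hc (h ▸ le_rfl)
    have hne : M b ≠ M' b := fun h' => hbc (M'.injective (h'.symm.trans h))
    have hlt : rB b (M b) < rB b (M' b) := lt_of_le_of_ne hb fun h' => hne (hrB b h')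
    have h1 := hM' b (M b)
    have h2 := hM c (M b)
    have hs : M'.symm (M b) = c := by rw [h, Equiv.symm_apply_apply]
    rw [hs] at h1
    rw [Equiv.symm_apply_apply] at h2
    rw [← h] at hc
    have h3 : rG (M b) b ≠ rG (M b) c := fun h' => hbc (hrG _ h')
    omega
  let f : B → G := fun b => if rB b (M b) ≤ rB b (M' b) then M b else M' b
  let k : B → G := fun b => if rB b (M b) ≤ rB b (M' b) then M' b else M b
  have hf : Function.Bijective f := by
    refine (Fintype.bijective_iff_injective_and_card f).2 ⟨fun b c h => ?_, hcard⟩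
    dsimp only [f] at h
    split_ifs at h with hb hc hc
    · exact M.injective h
    · exact absurd h (cross hb hc)
    · exact absurd h.symm (cross hc hb)
    · exact M'.injective h
  -- No girl is the worse partner of two distinct boys.
  have cross' {b c : B} (hb : rB b (M b) ≤ rB b (M' b)) (hc : ¬ rB c (M c) ≤ rB c (M' c)) :
      M' b ≠ M c := by
    intro h
    obtain ⟨d, hd⟩ := hf.surjective (M c)
    dsimp only [f] at hd
    split_ifs at hd with hdS
    · exact hc (M.injective hd ▸ hdS)
    · exact hdS (M'.injective (hd.trans h.symm) ▸ hb)
  have hk : Function.Bijective k := by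
    refine (Fintype.bijective_iff_injective_and_card k).2 ⟨fun b c h => ?_, hcard⟩
    dsimp only [k] at h
    split_ifs at h with hb hc hc
    · exact M'.injective h
    · exact absurd h (cross' hb hc)
    · exact absurd h.symm (cross' hc hb)
    · exact M.injective h
  refine ⟨Equiv.ofBijective f hf, Equiv.ofBijective k hk, fun _ => rfl, fun _ => rfl, ?_, ?_⟩
  · rintro b g ⟨hb, hg⟩
    obtain ⟨c, rfl⟩ := hf.surjective g
    rw [Equiv.ofBijective_symm_apply_apply] at hg
    rw [Equiv.ofBijective_apply] at hb
    have h1 := hM b (f c)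
    have h2 := hM' b (f c)
    have hfb : rB b (f b) ≤ rB b (M b) ∧ rB b (f b) ≤ rB b (M' b) := by
      dsimp only [f]; split_ifs <;> omega
    have hfc : f c = M c ∨ f c = M' c := by
      dsimp only [f]; split_ifs <;> simp
    rcases hfc with h | h
    · rw [show M.symm (f c) = c by rw [h, Equiv.symm_apply_apply]] at h1
      omega
    · rw [show M'.symm (f c) = c by rw [h, Equiv.symm_apply_apply]] at h2
      omega
  · rintro b g ⟨hb, hg⟩
    obtain ⟨c, rfl⟩ := hk.surjective g
    rw [Equiv.ofBijective_symm_apply_apply] at hg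
    rw [Equiv.ofBijective_apply] at hb
    -- The girl's partner in the join is at least as good as each of her two partners.
    have hjoin : rG (k c) c ≤ rG (k c) (M.symm (k c)) ∧
        rG (k c) c ≤ rG (k c) (M'.symm (k c)) := by
      by_cases hc : rB c (M c) ≤ rB c (M' c)
      · have hkc : k c = M' c := if_pos hc
        have hs : M'.symm (k c) = c := by rw [hkc, Equiv.symm_apply_apply]
        refine ⟨not_lt.1 fun hlt => ?_, hs.symm ▸ le_rfl⟩
        obtain ⟨d, hd⟩ := M.surjective (k c)
        have h1 := hM' d (k c)
        rw [← hd, Equiv.symm_apply_apply, hd] at hlt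
        rw [hs] at h1
        have hdc : d ≠ c := by rintro rfl; exact lt_irrefl _ hlt
        by_cases hdS : rB d (M d) ≤ rB d (M' d)
        · rw [← hd] at h1 hlt
          have heq : M d = M' d := hrB d (by omega)
          exact hdc (M'.injective (heq.symm.trans (hd.trans hkc)))
        · exact cross' hc hdS (hkc.symm.trans hd.symm)
      · have hkc : k c = M c := if_neg hc
        have hs : M.symm (k c) = c := by rw [hkc, Equiv.symm_apply_apply]
        refine ⟨hs.symm ▸ le_rfl, not_lt.1 fun hlt => ?_⟩
        obtain ⟨d, hd⟩ := M'.surjective (k c)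
        have h1 := hM d (k c)
        rw [← hd, Equiv.symm_apply_apply, hd] at hlt
        rw [hs] at h1
        by_cases hdS : rB d (M d) ≤ rB d (M' d)
        · exact cross' hdS hc (hd.trans hkc)
        · rw [← hd] at h1 hlt
          omega
    have h1 := hM b (k c)
    have h2 := hM' b (k c)
    have hkb : k b = M b ∨ k b = M' b := by
      dsimp only [k]; split_ifs <;> simp
    rcases hkb with h | h
    · rw [h] at hb; omega
    · rw [h] at hb; omega

theorem matchWeight_meet_add_join {B G : Type*} [Fintype B] (w : B → G → ℚ)
    (p : B → Prop) [DecidablePred p] {M M' Mmeet Mjoin : B ≃ G}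
    (hmeet : ∀ b, Mmeet b = if p b then M b else M' b)
    (hjoin : ∀ b, Mjoin b = if p b then M' b else M b) :
    matchWeight w Mmeet + matchWeight w Mjoin = matchWeight w M + matchWeight w M' := by
  simp only [matchWeight, ← Finset.sum_add_distrib]
  refine Finset.sum_congr rfl fun b _ => ?_
  rw [hmeet, hjoin]
  split_ifs
  · rfl
  · exact add_comm _ _

theorem exists_biOptimal {B G : Type*} [Fintype B] [Fintype G]
    {rB : B → G → ℕ} {rG : G → B → ℕ} (w1 w2 : B → G → ℚ)
    (h : ∃ M : B ≃ G, StableM rB rG M) : ∃ M : B ≃ G, BiOptimal rB rG w1 w2 M := by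
  obtain ⟨M, hM, hmax⟩ := Set.exists_max_image {M : B ≃ G | StableM rB rG M}
    (matchWeight w1) (Set.toFinite _) h
  exact Set.exists_max_image {M : B ≃ G | MaxWtStable rB rG w1 M}
    (matchWeight w2) (Set.toFinite _) ⟨M, hM, hmax⟩

/-- Given two weight functions `w¹, w²`, the set of stable matchings maximizing
`Σ w²` among those maximizing `Σ w¹` is nonempty and forms a sublattice of the
stable matching lattice (closed under the boy-better meet and boy-worse join). -/
theorem biObjective_sublattice {B G : Type*} [Fintype B] [Fintype G]
    [DecidableEq B] [DecidableEq G]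
    (rB : B → G → ℕ) (rG : G → B → ℕ)
    (hrB : ∀ b, Function.Injective (rB b)) (hrG : ∀ g, Function.Injective (rG g))
    (hcard : Fintype.card B = Fintype.card G)
    (w1 w2 : B → G → ℚ) :
    (∃ M : B ≃ G, BiOptimal rB rG w1 w2 M) ∧
      ∀ M M' : B ≃ G, BiOptimal rB rG w1 w2 M → BiOptimal rB rG w1 w2 M' →
        ∃ Mmeet Mjoin : B ≃ G,
          (∀ b, Mmeet b = if rB b (M b) ≤ rB b (M' b) then M b else M' b) ∧
          (∀ b, Mjoin b = if rB b (M b) ≤ rB b (M' b) then M' b else M b) ∧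
          BiOptimal rB rG w1 w2 Mmeet ∧ BiOptimal rB rG w1 w2 Mjoin := by
  refine ⟨exists_biOptimal w1 w2 (exists_stableM rB rG hrB hrG hcard), ?_⟩
  rintro M M' ⟨⟨hM, h1⟩, h2⟩ ⟨⟨hM', h1'⟩, h2'⟩
  obtain ⟨Mmeet, Mjoin, hmeet, hjoin, hs, hs'⟩ := hM.exists_meet_join hrB hrG hM'
  have hw1 := matchWeight_meet_add_join w1 _ hmeet hjoin
  have hw2 := matchWeight_meet_add_join w2 _ hmeet hjoin
  have hmeet1 : MaxWtStable rB rG w1 Mmeet :=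
    ⟨hs, fun N hN => by linarith [h1 N hN, h1' Mjoin hs']⟩
  have hjoin1 : MaxWtStable rB rG w1 Mjoin :=
    ⟨hs', fun N hN => by linarith [h1 N hN, h1' Mmeet hs]⟩
  refine ⟨Mmeet, Mjoin, hmeet, hjoin, ⟨hmeet1, fun N hN => ?_⟩, ⟨hjoin1, fun N hN => ?_⟩⟩
  · linarith [h2 N hN, h2' Mjoin hjoin1]
  · linarith [h2 N hN, h2' Mmeet hmeet1]
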